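/- Let n = qd + r with 0 ≤ r < d, and let P_{n,d} be the d-divided poset on [n]. Then the lattice L(P_{n,d}) of lower order ideals of P_{n,d} admits a nested chain decomposition which is symmetric if d divides n and top centered otherwise; consequently its rank sequence is symmetric or top interlacing, respectively. -/

import Mathlib

/-- `C` is a saturated chain in the poset `P`: it is nonempty, totally ordered,
and consecutive elements of `C` are covering pairs of `P`. -/
def IsSaturatedChain {P : Type*} [PartialOrder P] (C : Finset P) : Prop :=
  C.Nonempty ∧ (∀ x ∈ C, ∀ y ∈ C, x ≤ y ∨ y ≤ x) ∧
    ∀ x ∈ C, ∀ y ∈ C, x < y → (∀ z ∈ C, ¬(x < z ∧ z < y)) → x ⋖ y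

/-- `x` and `y` are the bottom and top elements of the chain `C`. -/
def ChainEnds {P : Type*} [PartialOrder P] (C : Finset P) (x y : P) : Prop :=
  x ∈ C ∧ y ∈ C ∧ (∀ z ∈ C, x ≤ z) ∧ ∀ z ∈ C, z ≤ y

/-- `𝒞` is a chain decomposition of `P`: a partition of `P` into saturated chains. -/
def IsChainDecomp {P : Type*} [PartialOrder P] (𝒞 : Finset (Finset P)) : Prop :=
  (∀ C ∈ 𝒞, IsSaturatedChain C) ∧
  (∀ C ∈ 𝒞, ∀ D ∈ 𝒞, C ≠ D → Disjoint C D) ∧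
  ∀ x : P, ∃ C ∈ 𝒞, x ∈ C

/-- The sequence `a₀,…,a_n` is top interlacing:
`a₀ ≤ a_n ≤ a₁ ≤ a_{n-1} ≤ … ≤ a_{⌈n/2⌉}`. -/
def TopInterlacing (r : ℕ → ℕ) (n : ℕ) : Prop :=
  (∀ i, 2 * i < n → r i ≤ r (n - i)) ∧ ∀ i, 2 * i + 1 < n → r (n - i) ≤ r (i + 1)

/-- The sequence `a₀,…,a_n` is bottom interlacing:
`a_n ≤ a₀ ≤ a_{n-1} ≤ a₁ ≤ … ≤ a_{⌊n/2⌋}`. -/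
def BottomInterlacing (r : ℕ → ℕ) (n : ℕ) : Prop :=
  (∀ i, 2 * i < n → r (n - i) ≤ r i) ∧ ∀ i, 2 * i + 1 < n → r i ≤ r (n - 1 - i)

/-- The order relation of the `d`-divided poset `P_{n,d}` on the labels
`1,…,n`, where `n = qd + r`, `0 ≤ r < d`: full segments
`(k-1)d+1 < ⋯ < kd` for `1 ≤ k ≤ q`, the final segment `qd+1 < ⋯ < n`
(of `r` elements), and cross covers `(k-1)d+1 ⋖ (k+1)d` (with
`(q-1)d+1 ⋖ n` when `r > 0`). -/
def ddLe (n d : ℕ) (p q : ℕ) : Prop :=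
  p = q ∨
  (∃ k, 1 ≤ k ∧ k * d ≤ n ∧ (k - 1) * d + 1 ≤ p ∧ p ≤ q ∧ q ≤ k * d) ∨
  ((n / d) * d + 1 ≤ p ∧ p ≤ q ∧ q ≤ n) ∨
  (∃ k, 1 ≤ k ∧ (k + 1) * d ≤ n ∧ p = (k - 1) * d + 1 ∧ q = (k + 1) * d) ∨
  (n % d ≠ 0 ∧ 1 ≤ n / d ∧ p = (n / d - 1) * d + 1 ∧ q = n)

/-- `I` is a lower order ideal of `P_{n,d}`. -/
def IsDDIdeal (n d : ℕ) (I : Finset ℕ) : Prop :=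
  (∀ x ∈ I, 1 ≤ x ∧ x ≤ n) ∧ ∀ p q : ℕ, ddLe n d p q → q ∈ I → p ∈ I

/-- Number of unmatched zeros in the first `k` blocks of the bracketing of the word whose
`i`-th block consists of `a i` ones followed by `c i - a i` zeros, where a zero is matched with
a later one. -/
def freeZeros (c a : ℕ → ℕ) : ℕ → ℕ
  | 0 => 0
  | k + 1 => (freeZeros c a k - a k) + (c k - a k)

/-- Number of unmatched ones in the first `k` blocks. -/
def freeOnes (c a : ℕ → ℕ) : ℕ → ℕ
  | 0 => 0
  | k + 1 => freeOnes c a k + (a k - freeZeros c a k)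

/-- Number of matched ones in block `k`. -/
def matchedOnes (c a : ℕ → ℕ) (k : ℕ) : ℕ := min (a k) (freeZeros c a k)

theorem freeZeros_congr {c a b : ℕ → ℕ} {N : ℕ} (h : ∀ k < N, a k = b k) :
    freeZeros c a N = freeZeros c b N := by
  induction N with
  | zero => rfl
  | succ N ih =>
    simp only [freeZeros]
    rw [ih fun k hk => h k (by omega), h N (by omega)]

theorem freeOnes_congr {c a b : ℕ → ℕ} {N : ℕ} (h : ∀ k < N, a k = b k) :
    freeOnes c a N = freeOnes c b N := by
  induction N with
  | zero => rfl
  | succ N ih =>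
    simp only [freeOnes]
    rw [ih fun k hk => h k (by omega), h N (by omega),
      freeZeros_congr fun k hk => h k (by omega)]

theorem two_mul_sum_add_freeZeros {c a : ℕ → ℕ} (hac : ∀ k, a k ≤ c k) (N : ℕ) :
    2 * ∑ k ∈ Finset.range N, a k + freeZeros c a N
      = freeOnes c a N + ∑ k ∈ Finset.range N, c k := by
  induction N with
  | zero => simp [freeZeros, freeOnes]
  | succ N ih =>
    have := hac N
    simp only [Finset.sum_range_succ, freeZeros, freeOnes]
    omega

theorem sum_add_freeOnes {c a b : ℕ → ℕ} {N : ℕ}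
    (h : ∀ k < N, matchedOnes c a k = matchedOnes c b k) :
    ∑ k ∈ Finset.range N, a k + freeOnes c b N = ∑ k ∈ Finset.range N, b k + freeOnes c a N := by
  induction N with
  | zero => simp [freeOnes]
  | succ N ih =>
    have h1 := ih fun k hk => h k (by omega)
    have h2 := h N (by omega)
    simp only [matchedOnes] at h2
    simp only [Finset.sum_range_succ, freeOnes]
    omega

theorem freeOnes_add_freeZeros {c a b : ℕ → ℕ} (hac : ∀ k, a k ≤ c k) (hbc : ∀ k, b k ≤ c k)
    {N : ℕ} (h : ∀ k < N, matchedOnes c a k = matchedOnes c b k) :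
    freeOnes c a N + freeZeros c a N = freeOnes c b N + freeZeros c b N := by
  have h1 := two_mul_sum_add_freeZeros hac N
  have h2 := two_mul_sum_add_freeZeros hbc N
  have h3 := sum_add_freeOnes h
  omega

theorem le_of_freeOnes_le {c a b : ℕ → ℕ} (hac : ∀ k, a k ≤ c k) (hbc : ∀ k, b k ≤ c k)
    {N : ℕ} (h : ∀ k < N, matchedOnes c a k = matchedOnes c b k)
    (hle : freeOnes c a N ≤ freeOnes c b N) : ∀ k < N, a k ≤ b k := by
  induction N with
  | zero => simp
  | succ N ih =>
    have h1 : ∀ k < N, matchedOnes c a k = matchedOnes c b k := fun k hk => h k (by omega)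
    have h2 := h N (by omega)
    have h3 := freeOnes_add_freeZeros hac hbc h1
    simp only [matchedOnes] at h2
    simp only [freeOnes] at hle
    intro k hk
    rcases Nat.lt_succ_iff_lt_or_eq.1 hk with hk | rfl
    · exact ih h1 (by omega) k hk
    · omega

theorem exists_freeOnes_succ {c a : ℕ → ℕ} (hac : ∀ k, a k ≤ c k) {N : ℕ}
    (hpos : 0 < freeZeros c a N) :
    ∃ b : ℕ → ℕ, (∀ k, b k ≤ c k) ∧ (∀ k < N, matchedOnes c b k = matchedOnes c a k) ∧
      (∀ k ≥ N, b k = a k) ∧ freeOnes c b N = freeOnes c a N + 1 := by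
  induction N with
  | zero => simp [freeZeros] at hpos
  | succ N ih =>
    simp only [freeZeros] at hpos
    by_cases hlt : a N < freeZeros c a N
    · obtain ⟨b, hbc, hm, hb, ho⟩ := ih (by omega)
      have hz := freeOnes_add_freeZeros hbc hac hm
      have hN := hb N le_rfl
      refine ⟨b, hbc, fun k hk => ?_, fun k hk => hb k (by omega), ?_⟩
      · rcases Nat.lt_succ_iff_lt_or_eq.1 hk with hk | rfl
        · exact hm k hk
        · simp only [matchedOnes]; omega
      · simp only [freeOnes]; omega
    · have hb : ∀ k < N, Function.update a N (a N + 1) k = a k := fun k hk =>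
        Function.update_of_ne hk.ne _ _
      have hz := freeZeros_congr (c := c) hb
      have ho := freeOnes_congr (c := c) hb
      refine ⟨Function.update a N (a N + 1), fun k => ?_, fun k hk => ?_, fun k hk => ?_, ?_⟩
      · rcases eq_or_ne k N with rfl | hk
        · rw [Function.update_self]; omega
        · rw [Function.update_of_ne hk]; exact hac k
      · rcases Nat.lt_succ_iff_lt_or_eq.1 hk with hk | rfl
        · simp only [matchedOnes, hb k hk]
          rw [freeZeros_congr fun i hi => hb i (by omega)]
        · simp only [matchedOnes, hz, Function.update_self]; omega
      · exact Function.update_of_ne (by omega) _ _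
      · simp only [freeOnes, hz, ho, Function.update_self]; omega

theorem exists_succ_freeOnes {c a : ℕ → ℕ} (hac : ∀ k, a k ≤ c k) {N : ℕ}
    (hpos : 0 < freeOnes c a N) :
    ∃ b : ℕ → ℕ, (∀ k, b k ≤ c k) ∧ (∀ k < N, matchedOnes c b k = matchedOnes c a k) ∧
      (∀ k ≥ N, b k = a k) ∧ freeOnes c b N + 1 = freeOnes c a N := by
  induction N with
  | zero => simp [freeOnes] at hpos
  | succ N ih =>
    simp only [freeOnes] at hpos
    by_cases hlt : a N ≤ freeZeros c a N
    · obtain ⟨b, hbc, hm, hb, ho⟩ := ih (by omega)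
      have hz := freeOnes_add_freeZeros hbc hac hm
      have hN := hb N le_rfl
      refine ⟨b, hbc, fun k hk => ?_, fun k hk => hb k (by omega), ?_⟩
      · rcases Nat.lt_succ_iff_lt_or_eq.1 hk with hk | rfl
        · exact hm k hk
        · simp only [matchedOnes]; omega
      · simp only [freeOnes]; omega
    · have hb : ∀ k < N, Function.update a N (a N - 1) k = a k := fun k hk =>
        Function.update_of_ne hk.ne _ _
      have hz := freeZeros_congr (c := c) hb
      have ho := freeOnes_congr (c := c) hb
      have haN := hac N
      refine ⟨Function.update a N (a N - 1), fun k => ?_, fun k hk => ?_, fun k hk => ?_, ?_⟩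
      · rcases eq_or_ne k N with rfl | hk
        · rw [Function.update_self]; omega
        · rw [Function.update_of_ne hk]; exact hac k
      · rcases Nat.lt_succ_iff_lt_or_eq.1 hk with hk | rfl
        · simp only [matchedOnes, hb k hk]
          rw [freeZeros_congr fun i hi => hb i (by omega)]
        · simp only [matchedOnes, hz, Function.update_self]; omega
      · exact Function.update_of_ne (by omega) _ _
      · simp only [freeOnes, hz, ho, Function.update_self]; omega

/-- Whether block `k + 1` consists of ones that are all matched within block `k`
can be read off from the numbers of matched ones. -/
theorem full_and_add_le_iff {c a : ℕ → ℕ} (hac : ∀ k, a k ≤ c k) (k : ℕ) :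
    (a (k + 1) = c (k + 1) ∧ a k + c (k + 1) ≤ c k) ↔
      (matchedOnes c a (k + 1) = c (k + 1) ∧ matchedOnes c a k + c (k + 1) ≤ c k) := by
  have h1 := hac k
  have h2 := hac (k + 1)
  simp only [matchedOnes, freeZeros]
  omega

theorem full_and_add_le_congr {c a b : ℕ → ℕ} (hac : ∀ k, a k ≤ c k) (hbc : ∀ k, b k ≤ c k)
    {k : ℕ} (h : matchedOnes c a k = matchedOnes c b k)
    (h' : matchedOnes c a (k + 1) = matchedOnes c b (k + 1)) :
    (a (k + 1) = c (k + 1) ∧ a k + c (k + 1) ≤ c k) ↔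
      (b (k + 1) = c (k + 1) ∧ b k + c (k + 1) ≤ c k) := by
  rw [full_and_add_le_iff hac, full_and_add_le_iff hbc, h, h']

/-- A labelling of the elements of a finite poset by chains, with `lo x` (resp. `hi x`) the number
of elements below (resp. above) `x` in its chain. -/
structure ChainLabelling (X : Type*) [PartialOrder X] (rk : X → ℕ) (ι : Type*) where
  lab : X → ι
  lo : X → ℕ
  hi : X → ℕ
  le_of_lo_le : ∀ x y, lab x = lab y → lo x ≤ lo y → x ≤ y
  rk_add_lo : ∀ x y, lab x = lab y → rk x + lo y = rk y + lo x
  lo_add_hi : ∀ x y, lab x = lab y → lo x + hi x = lo y + hi y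
  exists_up : ∀ x, 0 < hi x → ∃ y, lab y = lab x ∧ lo y = lo x + 1
  exists_down : ∀ x, 0 < lo x → ∃ y, lab y = lab x ∧ lo y + 1 = lo x

namespace ChainLabelling

variable {X : Type*} [PartialOrder X] {rk : X → ℕ} {ι : Type*} (L : ChainLabelling X rk ι)

theorem exists_lo_eq (x : X) {k : ℕ} (hk : k ≤ L.lo x + L.hi x) :
    ∃ y, L.lab y = L.lab x ∧ L.lo y = k := by
  have hdown : ∀ m ≤ L.lo x, ∃ y, L.lab y = L.lab x ∧ L.lo y + m = L.lo x := by
    intro m hm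
    induction m with
    | zero => exact ⟨x, rfl, rfl⟩
    | succ m ih =>
      obtain ⟨y, hy, hlo⟩ := ih (by omega)
      obtain ⟨z, hz, hz'⟩ := L.exists_down y (by omega)
      exact ⟨z, hz.trans hy, by omega⟩
  have hup : ∀ m ≤ L.hi x, ∃ y, L.lab y = L.lab x ∧ L.lo y = L.lo x + m := by
    intro m hm
    induction m with
    | zero => exact ⟨x, rfl, rfl⟩
    | succ m ih =>
      obtain ⟨y, hy, hlo⟩ := ih (by omega)
      have := L.lo_add_hi _ _ hy
      obtain ⟨z, hz, hz'⟩ := L.exists_up y (by omega)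
      exact ⟨z, hz.trans hy, by omega⟩
  rcases le_total k (L.lo x) with h | h
  · obtain ⟨y, hy, hlo⟩ := hdown (L.lo x - k) (by omega)
    exact ⟨y, hy, by omega⟩
  · obtain ⟨y, hy, hlo⟩ := hup (k - L.lo x) (by omega)
    exact ⟨y, hy, by omega⟩

theorem card_rank_le [Finite X] {i j : ℕ}
    (h : ∀ x, rk x = i → i ≤ j + L.lo x ∧ j ≤ i + L.hi x) :
    Nat.card {x : X // rk x = i} ≤ Nat.card {x : X // rk x = j} := by
  have key : ∀ x : {x : X // rk x = i}, ∃ y : {x : X // rk x = j}, L.lab y.1 = L.lab x.1 := by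
    rintro ⟨x, hx⟩
    obtain ⟨h1, h2⟩ := h x hx
    obtain ⟨y, hy, hlo⟩ := L.exists_lo_eq x (k := j + L.lo x - i) (by omega)
    have := L.rk_add_lo _ _ hy
    exact ⟨⟨y, by omega⟩, hy⟩
  choose f hf using key
  refine Nat.card_le_card_of_injective f fun x y hxy => ?_
  have hl : L.lab x.1 = L.lab y.1 := by rw [← hf x, ← hf y, hxy]
  have hr := L.rk_add_lo _ _ hl
  rw [x.2, y.2] at hr
  exact Subtype.ext (le_antisymm (L.le_of_lo_le _ _ hl (by omega))
    (L.le_of_lo_le _ _ hl.symm (by omega)))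

theorem exists_isChainDecomp [Finite X] (hrk : StrictMono rk) :
    ∃ 𝒞 : Finset (Finset X), IsChainDecomp 𝒞 ∧ ∀ C ∈ 𝒞, ∀ x y, ChainEnds C x y →
      L.lab x = L.lab y ∧ L.lo x = 0 ∧ L.hi y = 0 := by
  classical
  have := Fintype.ofFinite X
  have rk_lt : ∀ x y, L.lab x = L.lab y → L.lo x < L.lo y → x < y := fun x y h hlo =>
    lt_of_le_of_ne (L.le_of_lo_le x y h hlo.le) (by rintro rfl; exact hlo.false)
  refine ⟨Finset.univ.image fun x => Finset.univ.filter fun y => L.lab y = L.lab x,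
    ⟨?_, ?_, ?_⟩, ?_⟩
  · simp only [Finset.mem_image, Finset.mem_univ, true_and, forall_exists_index]
    rintro _ a rfl
    simp only [IsSaturatedChain, Finset.mem_filter, Finset.mem_univ, true_and]
    refine ⟨⟨a, by simp⟩, fun x hx y hy => ?_, fun x hx y hy hlt hz => ⟨hlt, fun z h1 h2 => ?_⟩⟩
    · exact (le_total (L.lo x) (L.lo y)).imp (L.le_of_lo_le x y (hx.trans hy.symm))
        (L.le_of_lo_le y x (hy.trans hx.symm))
    · have hxy := hx.trans hy.symm
      have e1 := L.rk_add_lo _ _ hxy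
      have e2 := L.lo_add_hi _ _ hxy
      have e3 := hrk h1
      have e4 := hrk h2
      obtain ⟨w, hw, hlo⟩ := L.exists_lo_eq x (k := L.lo x + 1) (by omega)
      exact hz w (hw.trans hx) ⟨rk_lt _ _ hw.symm (by omega),
        rk_lt _ _ (hw.trans hxy) (by omega)⟩
  · simp only [Finset.mem_image, Finset.mem_univ, true_and, forall_exists_index]
    rintro _ a rfl _ b rfl hne
    rw [Finset.disjoint_left]
    simp only [Finset.mem_filter, Finset.mem_univ, true_and]
    intro x hx hy
    exact hne (by rw [← hx, ← hy])
  · exact fun x => ⟨_, Finset.mem_image_of_mem _ (Finset.mem_univ x), by simp⟩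
  · simp only [Finset.mem_image, Finset.mem_univ, true_and, forall_exists_index]
    rintro _ a rfl x y ⟨hx, hy, hbot, htop⟩
    simp only [Finset.mem_filter, Finset.mem_univ, true_and] at hx hy hbot htop
    refine ⟨hx.trans hy.symm, ?_, ?_⟩
    · by_contra h
      obtain ⟨z, hz, hlo⟩ := L.exists_down x (by omega)
      exact (hbot z (hz.trans hx)).not_gt (rk_lt _ _ hz (by omega))
    · by_contra h
      obtain ⟨z, hz, hlo⟩ := L.exists_up y (by omega)
      exact (htop z (hz.trans hy)).not_gt (rk_lt _ _ hz.symm (by omega))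

end ChainLabelling

/-- The sizes of the segments of `P_{n,d}` for `n = q * d + r`. -/
def segmentSize (d q r k : ℕ) : ℕ := if k < q then d else if k = q then r else 0

theorem sum_segmentSize (d r : ℕ) {q N : ℕ} (h : q < N) :
    ∑ k ∈ Finset.range N, segmentSize d q r k = q * d + r := by
  obtain ⟨m, rfl⟩ := Nat.exists_eq_add_of_lt h
  have h0 : ∑ k ∈ Finset.range q, segmentSize d q r k = q * d := by
    rw [Finset.sum_congr rfl fun k hk => show segmentSize d q r k = d from
      if_pos (Finset.mem_range.1 hk)]
    simp
  induction m with
  | zero => rw [Nat.add_zero, Finset.sum_range_succ, h0]; simp [segmentSize]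
  | succ m ih =>
    rw [show q + (m + 1) + 1 = q + m + 1 + 1 by omega, Finset.sum_range_succ, ih (by omega)]
    simp only [segmentSize]
    split_ifs <;> omega

/-- A sequence `a` records an order ideal of `P_{n,d}`: `a k` is the number of its elements in
the segment `k`. -/
def IsIdealWord (d q r : ℕ) (a : ℕ → ℕ) : Prop :=
  (∀ k, a k ≤ segmentSize d q r k) ∧
    ∀ k, 0 < segmentSize d q r (k + 1) → a (k + 1) = segmentSize d q r (k + 1) → a k ≠ 0

/-- The ideal contains the whole (nonempty) last partial segment, all of which is matched with
elements missing from the segment before. -/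
def IsExceptional (d q r : ℕ) (a : ℕ → ℕ) : Prop :=
  0 < q ∧ 0 < r ∧ a q = r ∧ a (q - 1) + r ≤ d

/-- Forget the last partial segment and the bottom of the segment before. -/
def lowerWord (q : ℕ) (a : ℕ → ℕ) (k : ℕ) : ℕ :=
  if k + 1 < q then a k else if k + 1 = q then a k - 1 else 0

/-- Add back what `lowerWord` forgets. -/
def raiseWord (q r : ℕ) (b : ℕ → ℕ) (k : ℕ) : ℕ :=
  if k + 1 < q then b k else if k + 1 = q then b k + 1 else if k = q then r else 0

namespace IsIdealWord

variable {d q r : ℕ} {a b : ℕ → ℕ}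

theorem pred_ne_zero (ha : IsIdealWord d q r a) (he : IsExceptional d q r a) : a (q - 1) ≠ 0 := by
  obtain ⟨hq, hr, h1, h2⟩ := he
  obtain ⟨q, rfl⟩ := Nat.exists_eq_add_of_lt hq
  have := ha.2 (0 + q)
  simp [segmentSize] at this h1 ⊢
  exact this hr h1

theorem raiseWord_lowerWord (ha : IsIdealWord d q r a) (he : IsExceptional d q r a) :
    raiseWord q r (lowerWord q a) = a := by
  have h0 := ha.pred_ne_zero he
  obtain ⟨hq, hr, h1, h2⟩ := he
  funext k
  have h3 := ha.1 k
  simp only [raiseWord, lowerWord, segmentSize] at *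
  rcases lt_trichotomy (k + 1) q with h | h | h
  · simp [h]
  · subst h
    simp at h0 ⊢
    omega
  · rw [if_neg (by omega), if_neg (by omega)]
    rcases eq_or_ne k q with rfl | h'
    · simp [h1]
    · rw [if_neg (by omega), if_neg (by omega)] at h3
      rw [if_neg h']; omega

theorem lowerWord_le (ha : IsIdealWord d q r a) (he : IsExceptional d q r a) (k : ℕ) :
    lowerWord q a k ≤ segmentSize d (q - 1) (d - r - 1) k := by
  have h0 := ha.pred_ne_zero he
  obtain ⟨hq, hr, h1, h2⟩ := he
  have h3 := ha.1 k
  simp only [lowerWord, segmentSize] at *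
  rcases lt_trichotomy (k + 1) q with h | h | h
  · rw [if_pos (by omega)] at h3
    rw [if_pos h, if_pos (by omega)]
    exact h3
  · subst h
    simp at h0 h2 ⊢
    omega
  · rw [if_neg (by omega), if_neg (by omega)]
    omega

theorem sum_eq_sum_lowerWord (ha : IsIdealWord d q r a) (he : IsExceptional d q r a) :
    ∑ k ∈ Finset.range (q + 1), a k = ∑ k ∈ Finset.range (q + 1), lowerWord q a k + 1 + r := by
  have h0 := ha.pred_ne_zero he
  obtain ⟨hq, hr, h1, h2⟩ := he
  obtain ⟨q, rfl⟩ := Nat.exists_eq_add_of_lt hq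
  have h3 : ∑ k ∈ Finset.range (0 + q), lowerWord (0 + q + 1) a k
      = ∑ k ∈ Finset.range (0 + q), a k :=
    Finset.sum_congr rfl fun k hk => if_pos (by simpa using Finset.mem_range.1 hk)
  simp only [Finset.sum_range_succ, h3]
  simp [lowerWord] at h0 h1 ⊢
  omega

theorem of_matchedOnes_eq (hrd : r < d) (ha : IsIdealWord d q r a) (he : ¬ IsExceptional d q r a)
    (hb : ∀ k, b k ≤ segmentSize d q r k)
    (h : ∀ k < q + 1, matchedOnes (segmentSize d q r) b k
      = matchedOnes (segmentSize d q r) a k) :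
    IsIdealWord d q r b ∧ ¬ IsExceptional d q r b := by
  have key : ∀ k < q, (b (k + 1) = segmentSize d q r (k + 1) ∧
      b k + segmentSize d q r (k + 1) ≤ segmentSize d q r k) ↔ _ := fun k hk =>
    full_and_add_le_congr hb ha.1 (h k (by omega)) (h (k + 1) (by omega))
  have hexc : ¬ IsExceptional d q r b := by
    rintro ⟨hq, hr, h1, h2⟩
    obtain ⟨q, rfl⟩ := Nat.exists_eq_add_of_lt hq
    have := key (0 + q) (by omega)
    simp [segmentSize] at this h1 h2
    exact he ⟨hq, hr, by simpa using (this.1 ⟨h1, h2⟩).1, by simpa using (this.1 ⟨h1, h2⟩).2⟩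
  refine ⟨⟨hb, fun k h1 h2 h3 => ?_⟩, hexc⟩
  have hk : k < q := by
    by_contra hk
    simp only [segmentSize] at h1
    rw [if_neg (by omega), if_neg (by omega)] at h1
    omega
  have hck : segmentSize d q r k = d := if_pos hk
  have hck' : segmentSize d q r (k + 1) ≤ d := by
    simp only [segmentSize]; split_ifs <;> omega
  obtain ⟨h4, h5⟩ := (key k hk).1 ⟨h2, by omega⟩
  rcases eq_or_ne (k + 1) q with rfl | hne
  · have : segmentSize d (k + 1) r (k + 1) = r := by simp [segmentSize]
    exact he ⟨by omega, by omega, by omega, by simp; omega⟩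
  · have : segmentSize d q r (k + 1) = d := if_pos (by omega)
    exact ha.2 k h1 h4 (by omega)

theorem raiseWord_of_matchedOnes_eq (hrd : r < d) (ha : IsIdealWord d q r a)
    (he : IsExceptional d q r a) (hb : ∀ k, b k ≤ segmentSize d (q - 1) (d - r - 1) k)
    (h : ∀ k < q + 1, matchedOnes (segmentSize d (q - 1) (d - r - 1)) b k
      = matchedOnes (segmentSize d (q - 1) (d - r - 1)) (lowerWord q a) k) :
    IsIdealWord d q r (raiseWord q r b) ∧ IsExceptional d q r (raiseWord q r b) ∧
      lowerWord q (raiseWord q r b) = b := by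
  have hla := ha.lowerWord_le he
  obtain ⟨hq, hr, h1, h2⟩ := he
  obtain ⟨p, rfl⟩ := Nat.exists_eq_add_of_lt hq
  simp only [Nat.zero_add, Nat.add_sub_cancel] at *
  have hbp : b p ≤ d - r - 1 := by simpa [segmentSize] using hb p
  have hbl : ∀ k < p, b k ≤ d := fun k hk => by simpa [segmentSize, hk] using hb k
  have hbg : ∀ k, p < k → b k = 0 := fun k hk => by
    simpa [segmentSize, hk.ne', hk.not_gt] using hb k
  have hap : a p ≠ 0 := by
    have := ha.2 p
    simp [segmentSize] at this
    exact this hr h1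
  refine ⟨⟨fun k => ?_, fun k h3 h4 h5 => ?_⟩, ⟨by omega, hr, ?_, ?_⟩, ?_⟩
  · simp only [raiseWord, segmentSize]
    rcases lt_trichotomy k p with h' | rfl | h'
    · rw [if_pos (by omega), if_pos (by omega)]; exact hbl k h'
    · simp; omega
    · rw [if_neg (by omega), if_neg (by omega)]
      split_ifs <;> omega
  · rcases lt_trichotomy k p with h' | rfl | h'
    · have e1 : segmentSize d (p + 1) r (k + 1) = d := if_pos (by omega)
      have e2 : raiseWord (p + 1) r b k = b k := if_pos (by omega)
      rw [e1] at h4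
      rw [e2] at h5
      rcases eq_or_ne (k + 1) p with rfl | hne
      · simp [raiseWord] at h4
        omega
      · have e3 : raiseWord (p + 1) r b (k + 1) = b (k + 1) := if_pos (by omega)
        have e4 : segmentSize d p (d - r - 1) (k + 1) = d := if_pos (by omega)
        have e5 : segmentSize d p (d - r - 1) k = d := if_pos h'
        have e6 : lowerWord (p + 1) a k = a k := if_pos (by omega)
        have e7 : lowerWord (p + 1) a (k + 1) = a (k + 1) := if_pos (by omega)
        have key := full_and_add_le_congr hb hla (h k (by omega)) (h (k + 1) (by omega))
        rw [e4, e5, e6, e7] at key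
        obtain ⟨h6, h7⟩ := key.1 ⟨by omega, by omega⟩
        exact ha.2 k h3 (by omega) (by omega)
    · simp [raiseWord] at h5
    · simp only [segmentSize] at h3
      rw [if_neg (by omega), if_neg (by omega)] at h3
      omega
  · simp [raiseWord]
  · simp [raiseWord]; omega
  · funext k
    simp only [raiseWord, lowerWord]
    rcases lt_trichotomy k p with h' | rfl | h'
    · rw [if_pos (by omega), if_pos (by omega)]
    · simp
    · rw [if_neg (by omega), if_neg (by omega), hbg k h']

end IsIdealWord

open Classical in
/-- The segment sizes used for bracketing the word `a`. -/
noncomputable def bracketSize (d q r : ℕ) (a : ℕ → ℕ) : ℕ → ℕ :=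
  if IsExceptional d q r a then segmentSize d (q - 1) (d - r - 1) else segmentSize d q r

open Classical in
/-- The word used for bracketing the word `a`. -/
noncomputable def bracketWord (d q r : ℕ) (a : ℕ → ℕ) : ℕ → ℕ :=
  if IsExceptional d q r a then lowerWord q a else a

/-- Two words have the same chain label. -/
theorem bracketLabel_eq_iff {d q r : ℕ} {a b : ℕ → ℕ} :
    ((IsExceptional d q r a, fun k : Fin (q + 1) =>
        matchedOnes (bracketSize d q r a) (bracketWord d q r a) k) =
      ((IsExceptional d q r b, fun k : Fin (q + 1) =>
        matchedOnes (bracketSize d q r b) (bracketWord d q r b) k) : Prop × (Fin (q + 1) → ℕ))) ↔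
      (IsExceptional d q r a ↔ IsExceptional d q r b) ∧
        bracketSize d q r a = bracketSize d q r b ∧
        ∀ k < q + 1, matchedOnes (bracketSize d q r b) (bracketWord d q r a) k
          = matchedOnes (bracketSize d q r b) (bracketWord d q r b) k := by
  rw [Prod.mk.injEq, eq_iff_iff, funext_iff, Fin.forall_iff]
  refine and_congr_right fun h => ?_
  have hs : bracketSize d q r a = bracketSize d q r b := by
    by_cases he : IsExceptional d q r a
    · rw [bracketSize, bracketSize, if_pos he, if_pos (h.1 he)]
    · rw [bracketSize, bracketSize, if_neg he, if_neg (mt h.2 he)]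
  simp only [hs, true_and]

namespace IsIdealWord

variable {d q r : ℕ} {a b : ℕ → ℕ}

theorem bracketWord_le (ha : IsIdealWord d q r a) (k : ℕ) :
    bracketWord d q r a k ≤ bracketSize d q r a k := by
  unfold bracketWord bracketSize
  split_ifs with he
  · exact ha.lowerWord_le he k
  · exact ha.1 k

theorem sum_bracketWord (ha : IsIdealWord d q r a) (hb : IsIdealWord d q r b)
    (h : IsExceptional d q r a ↔ IsExceptional d q r b) :
    ∑ k ∈ Finset.range (q + 1), a k + ∑ k ∈ Finset.range (q + 1), bracketWord d q r b k
      = ∑ k ∈ Finset.range (q + 1), b k + ∑ k ∈ Finset.range (q + 1), bracketWord d q r a k := by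
  by_cases he : IsExceptional d q r a
  · have he' := h.1 he
    simp only [bracketWord, if_pos he, if_pos he']
    have := ha.sum_eq_sum_lowerWord he
    have := hb.sum_eq_sum_lowerWord he'
    omega
  · have he' := mt h.2 he
    simp only [bracketWord, if_neg he, if_neg he']
    omega

theorem le_of_bracketWord_le (ha : IsIdealWord d q r a) (hb : IsIdealWord d q r b)
    (h : IsExceptional d q r a ↔ IsExceptional d q r b)
    (hle : ∀ k < q + 1, bracketWord d q r a k ≤ bracketWord d q r b k) : a ≤ b := by
  by_cases he : IsExceptional d q r a
  · have he' := h.1 he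
    simp only [bracketWord, if_pos he, if_pos he'] at hle
    rw [← ha.raiseWord_lowerWord he, ← hb.raiseWord_lowerWord he']
    intro k
    simp only [raiseWord]
    have := hle k
    split_ifs <;> omega
  · have he' := mt h.2 he
    simp only [bracketWord, if_neg he, if_neg he'] at hle
    intro k
    by_cases hk : k < q + 1
    · exact hle k hk
    · have := ha.1 k
      simp only [segmentSize] at this
      rw [if_neg (by omega), if_neg (by omega)] at this
      exact this.trans (Nat.zero_le _)

theorem exists_bracketWord_eq (hrd : r < d) (ha : IsIdealWord d q r a)
    (hb : ∀ k, b k ≤ bracketSize d q r a k)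
    (h : ∀ k < q + 1, matchedOnes (bracketSize d q r a) b k
      = matchedOnes (bracketSize d q r a) (bracketWord d q r a) k) :
    ∃ b', IsIdealWord d q r b' ∧ (IsExceptional d q r b' ↔ IsExceptional d q r a) ∧
      bracketSize d q r b' = bracketSize d q r a ∧ bracketWord d q r b' = b := by
  by_cases he : IsExceptional d q r a
  · simp only [bracketSize, bracketWord, if_pos he] at h hb ⊢
    obtain ⟨h1, h2, h3⟩ := ha.raiseWord_of_matchedOnes_eq hrd he hb h
    exact ⟨_, h1, by simp [h2, he], by rw [if_pos h2], by rw [if_pos h2, h3]⟩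
  · simp only [bracketSize, bracketWord, if_neg he] at h hb ⊢
    obtain ⟨h1, h2⟩ := ha.of_matchedOnes_eq hrd he hb h
    exact ⟨_, h1, by simp [h2, he], by rw [if_neg h2], by rw [if_neg h2]⟩

theorem two_mul_sum_add (hrd : r < d) (ha : IsIdealWord d q r a) :
    2 * ∑ k ∈ Finset.range (q + 1), a k
        + freeZeros (bracketSize d q r a) (bracketWord d q r a) (q + 1)
      = freeOnes (bracketSize d q r a) (bracketWord d q r a) (q + 1) + (q * d + r) ∨
    0 < r ∧ 2 * ∑ k ∈ Finset.range (q + 1), a k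
        + freeZeros (bracketSize d q r a) (bracketWord d q r a) (q + 1)
      = freeOnes (bracketSize d q r a) (bracketWord d q r a) (q + 1) + (q * d + r + 1) := by
  have key := two_mul_sum_add_freeZeros ha.bracketWord_le (q + 1)
  by_cases he : IsExceptional d q r a
  · right
    have h1 := ha.sum_eq_sum_lowerWord he
    simp only [bracketSize, bracketWord, if_pos he] at key ⊢
    obtain ⟨hq, hr, -, -⟩ := he
    rw [sum_segmentSize _ _ (by omega)] at key
    obtain ⟨p, rfl⟩ := Nat.exists_eq_add_of_lt hq
    have : (0 + p + 1) * d = (0 + p + 1 - 1) * d + d := by simp; ring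
    omega
  · left
    simp only [bracketSize, bracketWord, if_neg he] at key ⊢
    rwa [sum_segmentSize _ _ (by omega)] at key

end IsIdealWord

/-- The Greene–Kleitman bracketing, modified on exceptional words, labels the ideal words. -/
noncomputable def idealWordLabelling (d q r : ℕ) (hrd : r < d) :
    ChainLabelling {a : ℕ → ℕ // IsIdealWord d q r a}
      (fun a => ∑ k ∈ Finset.range (q + 1), a.1 k) (Prop × (Fin (q + 1) → ℕ)) where
  lab a := (IsExceptional d q r a, fun k =>
    matchedOnes (bracketSize d q r a) (bracketWord d q r a) k)
  lo a := freeOnes (bracketSize d q r a) (bracketWord d q r a) (q + 1)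
  hi a := freeZeros (bracketSize d q r a) (bracketWord d q r a) (q + 1)
  le_of_lo_le a b h hle := by
    obtain ⟨he, hs, hm⟩ := bracketLabel_eq_iff.1 h
    rw [hs] at hle
    exact a.2.le_of_bracketWord_le b.2 he
      (le_of_freeOnes_le (hs ▸ a.2.bracketWord_le) b.2.bracketWord_le hm hle)
  rk_add_lo a b h := by
    obtain ⟨he, hs, hm⟩ := bracketLabel_eq_iff.1 h
    have h1 := a.2.sum_bracketWord b.2 he
    have h2 := sum_add_freeOnes hm
    simp only [hs]
    omega
  lo_add_hi a b h := by
    obtain ⟨he, hs, hm⟩ := bracketLabel_eq_iff.1 h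
    simp only [hs]
    exact freeOnes_add_freeZeros (hs ▸ a.2.bracketWord_le) b.2.bracketWord_le hm
  exists_up a h := by
    obtain ⟨b, hb, hm, -, ho⟩ := exists_freeOnes_succ a.2.bracketWord_le h
    obtain ⟨b', hb', he, hs, rfl⟩ := a.2.exists_bracketWord_eq hrd hb hm
    exact ⟨⟨b', hb'⟩, bracketLabel_eq_iff.2 ⟨he, hs, hm⟩, by simpa only [hs] using ho⟩
  exists_down a h := by
    obtain ⟨b, hb, hm, -, ho⟩ := exists_succ_freeOnes a.2.bracketWord_le h
    obtain ⟨b', hb', he, hs, rfl⟩ := a.2.exists_bracketWord_eq hrd hb hm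
    exact ⟨⟨b', hb'⟩, bracketLabel_eq_iff.2 ⟨he, hs, hm⟩, by simpa only [hs] using ho⟩

theorem segmentSize_le {d q r : ℕ} (hrd : r < d) (k : ℕ) : segmentSize d q r k ≤ d := by
  simp only [segmentSize]
  split_ifs <;> omega

theorem mul_add_add_one_le_iff {d q r : ℕ} (hrd : r < d) {k j : ℕ} (hj : j < d) :
    k * d + j + 1 ≤ q * d + r ↔ j < segmentSize d q r k := by
  simp only [segmentSize]
  rcases lt_trichotomy k q with h | rfl | h
  · have := Nat.mul_le_mul_right d (show k + 1 ≤ q by omega)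
    rw [Nat.succ_mul] at this
    rw [if_pos h]
    omega
  · simp
  · have := Nat.mul_le_mul_right d (show q + 1 ≤ k by omega)
    rw [Nat.succ_mul] at this
    rw [if_neg (by omega), if_neg (by omega)]
    omega

theorem eq_and_eq_of_mul_add_eq {d k j k' j' : ℕ} (hj : j < d) (hj' : j' < d)
    (h : k * d + j + 1 = k' * d + j' + 1) : k = k' ∧ j = j' := by
  have h1 : k = k' := by
    have e1 : (k * d + j) / d = k := by
      rw [mul_comm, Nat.mul_add_div (by omega), Nat.div_eq_of_lt hj, add_zero]
    have e2 : (k' * d + j') / d = k' := by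
      rw [mul_comm, Nat.mul_add_div (by omega), Nat.div_eq_of_lt hj', add_zero]
    rw [← e1, ← e2, Nat.succ_injective h]
  subst h1
  omega

theorem isDDIdeal_iff {d q r : ℕ} (hrd : r < d) {I : Finset ℕ} :
    IsDDIdeal (q * d + r) d I ↔
      (∀ x ∈ I, ∃ k, ∃ j < segmentSize d q r k, x = k * d + j + 1) ∧
      (∀ k, ∀ j < segmentSize d q r k, ∀ i ≤ j, k * d + j + 1 ∈ I → k * d + i + 1 ∈ I) ∧
      ∀ k, 0 < segmentSize d q r (k + 1) →
        (k + 1) * d + (segmentSize d q r (k + 1) - 1) + 1 ∈ I → k * d + 1 ∈ I := by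
  have hq : (q * d + r) / d = q := by
    rw [mul_comm, Nat.mul_add_div (by omega), Nat.div_eq_of_lt hrd, add_zero]
  have hr : (q * d + r) % d = r := by
    rw [mul_comm, Nat.mul_add_mod, Nat.mod_eq_of_lt hrd]
  have hle : ∀ k, k * d ≤ q * d + r ↔ k ≤ q := fun k => by
    refine ⟨fun h => ?_, fun h => (Nat.mul_le_mul_right d h).trans (Nat.le_add_right _ _)⟩
    by_contra h'
    have := Nat.mul_le_mul_right d (show q + 1 ≤ k by omega)
    rw [Nat.succ_mul] at this
    omega
  constructor
  · rintro ⟨h1, h2⟩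
    refine ⟨fun x hx => ?_, fun k j hj i hi hm => h2 _ _ ?_ hm, fun k hk hm => h2 _ _ ?_ hm⟩
    · obtain ⟨h3, h4⟩ := h1 x hx
      have h5 := Nat.div_add_mod' (x - 1) d
      have h6 := Nat.mod_lt (x - 1) (show 0 < d by omega)
      have h7 := (mul_add_add_one_le_iff (q := q) hrd (k := (x - 1) / d) h6).1 (by omega)
      exact ⟨_, _, h7, by omega⟩
    · rcases lt_trichotomy k q with h | rfl | h
      · rw [segmentSize, if_pos h] at hj
        refine Or.inr (Or.inl ⟨k + 1, by omega, (hle _).2 h, ?_⟩)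
        rw [Nat.add_sub_cancel, Nat.succ_mul]
        omega
      · simp only [segmentSize, lt_self_iff_false, if_false, if_true] at hj
        refine Or.inr (Or.inr (Or.inl ?_))
        rw [hq]
        omega
      · rw [segmentSize, if_neg (by omega), if_neg (by omega)] at hj
        omega
    · rcases lt_trichotomy (k + 1) q with h | rfl | h
      · rw [segmentSize, if_pos h]
        refine Or.inr (Or.inr (Or.inr (Or.inl ⟨k + 1, by omega, (hle _).2 h, by simp, ?_⟩)))
        rw [Nat.succ_mul (k + 1)]
        omega
      · simp only [segmentSize, lt_self_iff_false, if_false, if_true] at hk ⊢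
        refine Or.inr (Or.inr (Or.inr (Or.inr ?_)))
        rw [hq, hr]
        exact ⟨by omega, by omega, by simp, by omega⟩
      · rw [segmentSize, if_neg (by omega), if_neg (by omega)] at hk
        omega
  · rintro ⟨h1, h2, h3⟩
    refine ⟨fun x hx => ?_, fun x y hxy hy => ?_⟩
    · obtain ⟨k, j, hj, rfl⟩ := h1 x hx
      exact ⟨by omega,
        (mul_add_add_one_le_iff hrd (hj.trans_le (segmentSize_le hrd k))).2 hj⟩
    · have seg : ∀ k, k * d + 1 ≤ x → x ≤ y → y ≤ (k + 1) * d → x ∈ I := by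
        intro k hk1 hk2 hk3
        rw [Nat.succ_mul] at hk3
        obtain ⟨l, j, hj, rfl⟩ := h1 y hy
        have hj' := hj.trans_le (segmentSize_le hrd l)
        obtain ⟨rfl, -⟩ := eq_and_eq_of_mul_add_eq hj' (by omega)
          (show l * d + j + 1 = k * d + (l * d + j - k * d) + 1 by omega)
        have := h2 l j hj (x - (l * d + 1)) (by omega) hy
        rwa [show l * d + (x - (l * d + 1)) + 1 = x by omega] at this
      rcases hxy with rfl | ⟨k, hk1, hk2, hk3, hk4, hk5⟩ | ⟨hk1, hk2, hk3⟩ |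
        ⟨k, hk1, hk2, rfl, rfl⟩ | ⟨hk1, hk2, rfl, rfl⟩
      · exact hy
      · exact seg (k - 1) hk3 hk4 (by rwa [Nat.sub_add_cancel hk1])
      · rw [hq] at hk1
        exact seg q hk1 hk2 (by rw [Nat.succ_mul]; omega)
      · obtain ⟨k, rfl⟩ := Nat.exists_eq_add_of_le' hk1
        have hs : segmentSize d q r (k + 1) = d := if_pos (by have := (hle _).1 hk2; omega)
        refine h3 k (by omega) ?_
        rw [hs]
        rw [Nat.succ_mul] at hy
        rwa [show (k + 1) * d + (d - 1) + 1 = (k + 1) * d + d by omega]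
      · rw [hq] at hk2 ⊢
        rw [hr] at hk1
        obtain ⟨q, rfl⟩ := Nat.exists_eq_add_of_le' hk2
        have hs : segmentSize d (q + 1) r (q + 1) = r := by simp [segmentSize]
        refine h3 q (by omega) ?_
        rw [hs]
        rwa [show (q + 1) * d + (r - 1) + 1 = (q + 1) * d + r by omega]

/-- The numbers of elements of `I` in the segments. -/
def idealWord (d : ℕ) (I : Finset ℕ) (k : ℕ) : ℕ :=
  ((Finset.range d).filter fun j => k * d + j + 1 ∈ I).card

/-- The set with `a k` elements in the `k`-th segment, for `k ≤ q`. -/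
def wordIdeal (d q : ℕ) (a : ℕ → ℕ) : Finset ℕ :=
  (Finset.range (q + 1)).biUnion fun k => (Finset.range (a k)).image fun j => k * d + j + 1

theorem lt_card_iff_mem {S : Finset ℕ} (hS : ∀ j ∈ S, ∀ i ≤ j, i ∈ S) (j : ℕ) :
    j < S.card ↔ j ∈ S := by
  constructor
  · intro h
    by_contra hj
    have : S ⊆ Finset.range j := fun i hi => by
      rw [Finset.mem_range]
      by_contra hij
      exact hj (hS i hi j (by omega))
    have := Finset.card_le_card this
    rw [Finset.card_range] at this
    omega
  · intro h
    have : Finset.range (j + 1) ⊆ S := fun i hi =>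
      hS j h i (by rw [Finset.mem_range] at hi; omega)
    have := Finset.card_le_card this
    rw [Finset.card_range] at this
    omega

theorem lt_idealWord_iff {d q r : ℕ} (hrd : r < d) {I : Finset ℕ}
    (hI : IsDDIdeal (q * d + r) d I) {k j : ℕ} (hj : j < d) :
    j < idealWord d I k ↔ k * d + j + 1 ∈ I := by
  rw [idealWord, lt_card_iff_mem]
  · simp [hj]
  · simp only [Finset.mem_filter, Finset.mem_range]
    rintro j ⟨hj, hjI⟩ i hi
    have := (mul_add_add_one_le_iff hrd hj).1 (hI.1 _ hjI).2
    exact ⟨by omega, ((isDDIdeal_iff hrd).1 hI).2.1 k j this i hi hjI⟩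

theorem idealWord_le (d : ℕ) (I : Finset ℕ) (k : ℕ) : idealWord d I k ≤ d :=
  (Finset.card_filter_le _ _).trans (Finset.card_range d).le

theorem isIdealWord_idealWord {d q r : ℕ} (hrd : r < d) {I : Finset ℕ}
    (hI : IsDDIdeal (q * d + r) d I) : IsIdealWord d q r (idealWord d I) := by
  have hle : ∀ k, idealWord d I k ≤ segmentSize d q r k := by
    intro k
    by_contra! h
    have hd := idealWord_le d I k
    have := (lt_idealWord_iff hrd hI (by omega)).1 h
    have := (mul_add_add_one_le_iff hrd (by omega)).1 (hI.1 _ this).2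
    omega
  refine ⟨hle, fun k h1 h2 => ?_⟩
  have hs := segmentSize_le (q := q) hrd (k + 1)
  have h3 := (lt_idealWord_iff (k := k + 1) hrd hI
    (j := segmentSize d q r (k + 1) - 1) (by omega)).1 (by omega)
  have h4 := (lt_idealWord_iff (k := k) hrd hI (j := 0) (by omega)).2
    (((isDDIdeal_iff hrd).1 hI).2.2 k h1 h3)
  omega

theorem mem_wordIdeal {d q r : ℕ} (hrd : r < d) {a : ℕ → ℕ} (ha : ∀ k, a k ≤ segmentSize d q r k)
    {k j : ℕ} (hj : j < d) : k * d + j + 1 ∈ wordIdeal d q a ↔ j < a k := by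
  simp only [wordIdeal, Finset.mem_biUnion, Finset.mem_image, Finset.mem_range]
  constructor
  · rintro ⟨l, hl, i, hi, h⟩
    have := ha l
    have := segmentSize_le (q := q) hrd l
    obtain ⟨rfl, rfl⟩ := eq_and_eq_of_mul_add_eq (by omega) hj h
    exact hi
  · intro h
    refine ⟨k, ?_, j, h, rfl⟩
    by_contra hk
    have := ha k
    rw [segmentSize, if_neg (by omega), if_neg (by omega)] at this
    omega

theorem card_wordIdeal {d q r : ℕ} (hrd : r < d) {a : ℕ → ℕ}
    (ha : ∀ k, a k ≤ segmentSize d q r k) :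
    (wordIdeal d q a).card = ∑ k ∈ Finset.range (q + 1), a k := by
  have hlt : ∀ k, ∀ i < a k, i < d := fun k i hi =>
    hi.trans_le ((ha k).trans (segmentSize_le hrd k))
  rw [wordIdeal, Finset.card_biUnion]
  · refine Finset.sum_congr rfl fun k _ => ?_
    rw [Finset.card_image_of_injective _ fun i j h => by simpa using h, Finset.card_range]
  · intro k _ l _ hkl
    rw [Function.onFun, Finset.disjoint_left]
    simp only [Finset.mem_image, Finset.mem_range]
    rintro _ ⟨i, hi, rfl⟩ ⟨j, hj, h⟩
    exact hkl (eq_and_eq_of_mul_add_eq (hlt l j hj) (hlt k i hi) h).1.symm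

theorem isDDIdeal_wordIdeal {d q r : ℕ} (hrd : r < d) {a : ℕ → ℕ} (ha : IsIdealWord d q r a) :
    IsDDIdeal (q * d + r) d (wordIdeal d q a) := by
  refine (isDDIdeal_iff hrd).2 ⟨fun x hx => ?_, fun k j hj i hi h => ?_, fun k hk h => ?_⟩
  · simp only [wordIdeal, Finset.mem_biUnion, Finset.mem_image, Finset.mem_range] at hx
    obtain ⟨k, -, j, hj, rfl⟩ := hx
    exact ⟨k, j, hj.trans_le (ha.1 k), rfl⟩
  · have hs := segmentSize_le (q := q) hrd k
    rw [mem_wordIdeal hrd ha.1 (by omega)] at h ⊢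
    omega
  · have hs := segmentSize_le (q := q) hrd (k + 1)
    have h1 := ha.1 (k + 1)
    rw [mem_wordIdeal hrd ha.1 (by omega)] at h
    have := ha.2 k hk (by omega)
    exact (mem_wordIdeal (j := 0) hrd ha.1 (by omega)).2 (by omega)

theorem idealWord_wordIdeal {d q r : ℕ} (hrd : r < d) {a : ℕ → ℕ} (ha : IsIdealWord d q r a) :
    idealWord d (wordIdeal d q a) = a := by
  funext k
  have hle := idealWord_le d (wordIdeal d q a) k
  have hak := (ha.1 k).trans (segmentSize_le hrd k)
  have key : ∀ j < d, j < idealWord d (wordIdeal d q a) k ↔ j < a k := fun j hj =>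
    (lt_idealWord_iff hrd (isDDIdeal_wordIdeal hrd ha) hj).trans (mem_wordIdeal hrd ha.1 hj)
  refine le_antisymm ?_ ?_
  · by_contra! h
    exact (lt_irrefl _) ((key _ (by omega)).1 h)
  · by_contra! h
    exact (lt_irrefl _) ((key _ (by omega)).2 h)

theorem subset_of_idealWord_le {d q r : ℕ} (hrd : r < d) {I J : Finset ℕ}
    (hI : IsDDIdeal (q * d + r) d I) (hJ : IsDDIdeal (q * d + r) d J)
    (h : idealWord d I ≤ idealWord d J) : I ⊆ J := by
  intro x hx
  obtain ⟨k, j, hj, rfl⟩ := ((isDDIdeal_iff hrd).1 hI).1 x hx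
  have hjd := hj.trans_le (segmentSize_le hrd k)
  exact (lt_idealWord_iff hrd hJ hjd).1 (((lt_idealWord_iff hrd hI hjd).2 hx).trans_le (h k))

theorem idealWord_mono (d : ℕ) {I J : Finset ℕ} (h : I ⊆ J) : idealWord d I ≤ idealWord d J :=
  fun _ => Finset.card_le_card (Finset.monotone_filter_right _ fun _ _ hx => h hx)

/-- The lattice `L(P_{n,d})` is isomorphic to the poset of ideal words. -/
def idealOrderIso (d q r : ℕ) (hrd : r < d) :
    {I : Finset ℕ // IsDDIdeal (q * d + r) d I} ≃o {a : ℕ → ℕ // IsIdealWord d q r a} where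
  toFun I := ⟨idealWord d I.1, isIdealWord_idealWord hrd I.2⟩
  invFun a := ⟨wordIdeal d q a.1, isDDIdeal_wordIdeal hrd a.2⟩
  left_inv I := by
    have h := idealWord_wordIdeal hrd (isIdealWord_idealWord hrd I.2)
    have hw := isDDIdeal_wordIdeal hrd (isIdealWord_idealWord hrd I.2)
    exact Subtype.ext ((subset_of_idealWord_le hrd hw I.2 h.le).antisymm
      (subset_of_idealWord_le hrd I.2 hw h.ge))
  right_inv a := Subtype.ext (idealWord_wordIdeal hrd a.2)
  map_rel_iff' {I J} := ⟨fun h => subset_of_idealWord_le hrd I.2 J.2 h, fun h => idealWord_mono d h⟩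

theorem sum_idealOrderIso (d q r : ℕ) (hrd : r < d)
    (I : {I : Finset ℕ // IsDDIdeal (q * d + r) d I}) :
    ∑ k ∈ Finset.range (q + 1), (idealOrderIso d q r hrd I).1 k = I.1.card := by
  obtain ⟨a, rfl⟩ := (idealOrderIso d q r hrd).symm.surjective I
  rw [OrderIso.apply_symm_apply]
  exact (card_wordIdeal hrd a.2.1).symm

/-- The pullback of a labelling along an order isomorphism. -/
def ChainLabelling.comap {X Y ι : Type*} [PartialOrder X] [PartialOrder Y] {rkX : X → ℕ}
    {rkY : Y → ℕ} (L : ChainLabelling Y rkY ι) (e : X ≃o Y) (he : ∀ x, rkY (e x) = rkX x) :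
    ChainLabelling X rkX ι where
  lab x := L.lab (e x)
  lo x := L.lo (e x)
  hi x := L.hi (e x)
  le_of_lo_le x y h hle := e.le_iff_le.1 (L.le_of_lo_le _ _ h hle)
  rk_add_lo x y h := by rw [← he, ← he]; exact L.rk_add_lo _ _ h
  lo_add_hi x y h := L.lo_add_hi _ _ h
  exists_up x h := by
    obtain ⟨y, hy⟩ := L.exists_up _ h
    exact ⟨e.symm y, by simpa using hy⟩
  exists_down x h := by
    obtain ⟨y, hy⟩ := L.exists_down _ h
    exact ⟨e.symm y, by simpa using hy⟩

theorem finite_ddIdeal (n d : ℕ) : Finite {I : Finset ℕ // IsDDIdeal n d I} :=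
  Set.Finite.to_subtype <| (Finset.finite_toSet (Finset.Icc 1 n).powerset).subset fun I hI => by
    rw [Finset.mem_coe, Finset.mem_powerset]
    exact fun x hx => Finset.mem_Icc.2 (hI.1 x hx)

/-- A chain labelling of `L(P_{n,d})`, all of whose chains have center `n / 2` or, when `d ∤ n`,
possibly `(n + 1) / 2`. -/
theorem exists_chainLabelling (n d : ℕ) (hd : 0 < d) :
    ∃ (ι : Type) (L : ChainLabelling {I : Finset ℕ // IsDDIdeal n d I} (fun I => I.1.card) ι),
      ∀ I, 2 * I.1.card + L.hi I = L.lo I + n ∨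
        ¬ d ∣ n ∧ 2 * I.1.card + L.hi I = L.lo I + (n + 1) := by
  obtain ⟨q, r, hrd, rfl⟩ : ∃ q r, r < d ∧ n = q * d + r :=
    ⟨n / d, n % d, Nat.mod_lt _ hd, (Nat.div_add_mod' n d).symm⟩
  refine ⟨_, (idealWordLabelling d q r hrd).comap (idealOrderIso d q r hrd)
    (sum_idealOrderIso d q r hrd), fun I => ?_⟩
  rw [← sum_idealOrderIso d q r hrd I]
  refine ((idealOrderIso d q r hrd I).2.two_mul_sum_add hrd).imp id fun h => ⟨fun hdvd => ?_, h.2⟩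
  exact absurd (Nat.le_of_dvd h.1 ((Nat.dvd_add_right (Dvd.intro_left q rfl)).1 hdvd)) (by omega)

/-- Gansner's theorem: the lattice `L(P_{n,d})` (of rank `n`) admits a nested
chain decomposition which is symmetric if `d ∣ n` and top centered otherwise;
consequently its rank sequence is symmetric or top interlacing, respectively. -/
theorem ddivided_NCD (n d : ℕ) (hn : 0 < n) (hd : 0 < d) :
    ∃ 𝒞 : Finset (Finset {I : Finset ℕ // IsDDIdeal n d I}),
      IsChainDecomp 𝒞 ∧
      (∀ C ∈ 𝒞, ∀ D ∈ 𝒞, ∀ x y x' y', ChainEnds C x y → ChainEnds D x' y' →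
        Set.Icc x.1.card y.1.card ⊆ Set.Icc x'.1.card y'.1.card ∨
        Set.Icc x'.1.card y'.1.card ⊆ Set.Icc x.1.card y.1.card) ∧
      (∀ C ∈ 𝒞, ∀ x y, ChainEnds C x y →
        if d ∣ n then x.1.card + y.1.card = n
        else x.1.card + y.1.card = n ∨ x.1.card + y.1.card = n + 1) ∧
      (if d ∣ n then
        ∀ i ≤ n, Nat.card {I : {I : Finset ℕ // IsDDIdeal n d I} // I.1.card = i} =
          Nat.card {I : {I : Finset ℕ // IsDDIdeal n d I} // I.1.card = n - i}
      else
        TopInterlacing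
          (fun k => Nat.card {I : {I : Finset ℕ // IsDDIdeal n d I} // I.1.card = k}) n) := by

  have := finite_ddIdeal n d
  obtain ⟨ι, L, hL⟩ := exists_chainLabelling n d hd
  obtain ⟨𝒞, h𝒞, hends⟩ := L.exists_isChainDecomp fun _ _ h => Finset.card_lt_card h
  have center : ∀ C ∈ 𝒞, ∀ x y, ChainEnds C x y → x.1.card ≤ y.1.card ∧
      (x.1.card + y.1.card = n ∨ ¬ d ∣ n ∧ x.1.card + y.1.card = n + 1) := by
    intro C hC x y hxy
    obtain ⟨hlab, hx, hy⟩ := hends C hC x y hxy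
    have h1 := L.rk_add_lo _ _ hlab
    have h2 := L.lo_add_hi _ _ hlab
    refine ⟨by omega, ?_⟩
    rcases hL x with h | ⟨h, h'⟩
    · exact Or.inl (by omega)
    · exact Or.inr ⟨h, by omega⟩
  refine ⟨𝒞, h𝒞, fun C hC D hD x y x' y' hxy hxy' => ?_, fun C hC x y hxy => ?_, ?_⟩
  · have h1 := center C hC x y hxy
    have h2 := center D hD x' y' hxy'
    rw [Set.Icc_subset_Icc_iff h1.1, Set.Icc_subset_Icc_iff h2.1]
    omega
  · have := center C hC x y hxy
    split_ifs with hdvd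
    · tauto
    · tauto
  · split_ifs with hdvd
    · refine fun i hi => le_antisymm (L.card_rank_le fun x hx => ?_)
        (L.card_rank_le fun x hx => ?_)
      all_goals
        have := hL x
        simp only [hdvd, not_true_eq_false, false_and, or_false] at this
        omega
    · refine ⟨fun i hi => L.card_rank_le fun x hx => ?_, fun i hi => L.card_rank_le fun x hx => ?_⟩
      all_goals
        have := hL x
        omega
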